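/- Let u : ℝ × ℝ → ℝ be a smooth solution of equation (∗), let μ ∈ ℝ, let m₁ ∈ {−2, 1}, and let ε ∈ {+1, −1}. Define f₁₁ = u − u_{xx}, f₁₂ = 2u(u − u_{xx}) + (4/m₁)u u_x − 2u_x² − 2u², f₂₁ = μ(u − u_{xx}) + ε m₁√(1+μ²), f₂₂ = μ f₁₂, f₃₁ = ε√(1+μ²)(u − u_{xx}) + m₁ μ, f₃₂ = ε√(1+μ²) f₁₂. Then the three structure equations hold identically on ℝ × ℝ: ∂_x f₁₂ − ∂_t f₁₁ = f₃₁ f₂₂ − f₃₂ f₂₁, ∂_x f₂₂ − ∂_t f₂₁ = f₁₁ f₃₂ − f₁₂ f₃₁, and ∂_x f₃₂ − ∂_t f₃₁ = f₁₁ f₂₂ − f₁₂ f₂₁. -/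

import Mathlib

open Real MeasureTheory Set Filter

/-- Partial derivative of `u` with respect to the first (time) variable. -/
noncomputable def ut (u : ℝ × ℝ → ℝ) (t x : ℝ) : ℝ := deriv (fun s => u (s, x)) t
/-- Partial derivative of `u` with respect to the second (spatial) variable. -/
noncomputable def ux (u : ℝ × ℝ → ℝ) (t x : ℝ) : ℝ := deriv (fun y => u (t, y)) x
noncomputable def uxx (u : ℝ × ℝ → ℝ) (t x : ℝ) : ℝ := deriv (fun y => ux u t y) x
noncomputable def uxxx (u : ℝ × ℝ → ℝ) (t x : ℝ) : ℝ := deriv (fun y => uxx u t y) x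
noncomputable def utx (u : ℝ × ℝ → ℝ) (t x : ℝ) : ℝ := deriv (fun y => ut u t y) x
noncomputable def utxx (u : ℝ × ℝ → ℝ) (t x : ℝ) : ℝ := deriv (fun y => utx u t y) x

/-- `u` satisfies the Novikov-type equation (∗) at the point `(t, x)`. -/
def SolvesAt (u : ℝ × ℝ → ℝ) (t x : ℝ) : Prop :=
  ut u t x - utxx u t x =
    4 * u (t, x) * ux u t x + 2 * (ux u t x) ^ 2 + 2 * u (t, x) * uxx u t x
      - 6 * ux u t x * uxx u t x - 2 * u (t, x) * uxxx u t x

/-- `u` is a solution of the Novikov-type equation (∗) on all of `ℝ × ℝ`. -/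
def IsSolution (u : ℝ × ℝ → ℝ) : Prop := ∀ t x : ℝ, SolvesAt u t x

noncomputable def f11 (u : ℝ × ℝ → ℝ) (t x : ℝ) : ℝ := u (t, x) - uxx u t x

noncomputable def f12 (u : ℝ × ℝ → ℝ) (m₁ t x : ℝ) : ℝ :=
  2 * u (t, x) * (u (t, x) - uxx u t x) + (4 / m₁) * u (t, x) * ux u t x
    - 2 * (ux u t x) ^ 2 - 2 * (u (t, x)) ^ 2

noncomputable def f21 (u : ℝ × ℝ → ℝ) (μ m₁ ε t x : ℝ) : ℝ :=
  μ * (u (t, x) - uxx u t x) + ε * m₁ * Real.sqrt (1 + μ ^ 2)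

noncomputable def f22 (u : ℝ × ℝ → ℝ) (μ m₁ t x : ℝ) : ℝ := μ * f12 u m₁ t x

noncomputable def f31 (u : ℝ × ℝ → ℝ) (μ m₁ ε t x : ℝ) : ℝ :=
  ε * Real.sqrt (1 + μ ^ 2) * (u (t, x) - uxx u t x) + m₁ * μ

noncomputable def f32 (u : ℝ × ℝ → ℝ) (μ m₁ ε t x : ℝ) : ℝ :=
  ε * Real.sqrt (1 + μ ^ 2) * f12 u m₁ t x

theorem hasDerivAt_time {u : ℝ × ℝ → ℝ} (hu : Differentiable ℝ u) (t x : ℝ) :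
    HasDerivAt (fun s => u (s, x)) (fderiv ℝ u (t, x) (1, 0)) t :=
  (hu (t, x)).hasFDerivAt.comp_hasDerivAt t ((hasDerivAt_id t).prodMk (hasDerivAt_const t x))

theorem hasDerivAt_space {u : ℝ × ℝ → ℝ} (hu : Differentiable ℝ u) (t x : ℝ) :
    HasDerivAt (fun y => u (t, y)) (fderiv ℝ u (t, x) (0, 1)) x :=
  (hu (t, x)).hasFDerivAt.comp_hasDerivAt x ((hasDerivAt_const x t).prodMk (hasDerivAt_id x))

theorem ut_uncurried_eq_fderiv {u : ℝ × ℝ → ℝ} (hu : Differentiable ℝ u) :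
    (fun p : ℝ × ℝ => ut u p.1 p.2) = fun p => fderiv ℝ u p (1, 0) :=
  funext fun p => (hasDerivAt_time hu p.1 p.2).deriv

theorem ux_uncurried_eq_fderiv {u : ℝ × ℝ → ℝ} (hu : Differentiable ℝ u) :
    (fun p : ℝ × ℝ => ux u p.1 p.2) = fun p => fderiv ℝ u p (0, 1) :=
  funext fun p => (hasDerivAt_space hu p.1 p.2).deriv

theorem contDiff_fderiv_apply_const {u : ℝ × ℝ → ℝ} (hu : ContDiff ℝ (⊤ : ℕ∞) u) (v : ℝ × ℝ) :
    ContDiff ℝ (⊤ : ℕ∞) fun p => fderiv ℝ u p v :=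
  (hu.fderiv_right (by simp)).clm_apply contDiff_const

theorem contDiff_ux_uncurried {u : ℝ × ℝ → ℝ} (hu : ContDiff ℝ (⊤ : ℕ∞) u) :
    ContDiff ℝ (⊤ : ℕ∞) fun p : ℝ × ℝ => ux u p.1 p.2 := by
  rw [ux_uncurried_eq_fderiv (hu.differentiable (by simp))]
  exact contDiff_fderiv_apply_const hu _

/-- Symmetry of the mixed second partial derivatives. -/
theorem ut_ux_eq_utx {u : ℝ × ℝ → ℝ} (hu : ContDiff ℝ (⊤ : ℕ∞) u) (t x : ℝ) :
    ut (fun p => ux u p.1 p.2) t x = utx u t x := by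
  have hd : Differentiable ℝ u := hu.differentiable (by simp)
  have hd2 : DifferentiableAt ℝ (fderiv ℝ u) (t, x) :=
    ((hu.fderiv_right (m := (⊤ : ℕ∞)) (by simp)).differentiable (by simp)) _
  have hv (v : ℝ × ℝ) : Differentiable ℝ fun p => fderiv ℝ u p v :=
    (contDiff_fderiv_apply_const hu v).differentiable (by simp)
  have hv2 (v w : ℝ × ℝ) :
      fderiv ℝ (fun p => fderiv ℝ u p v) (t, x) w = fderiv ℝ (fderiv ℝ u) (t, x) w v := by
    rw [fderiv_clm_apply hd2 (differentiableAt_const v)]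
    simp
  have hsymm : IsSymmSndFDerivAt ℝ u (t, x) :=
    hu.contDiffAt.isSymmSndFDerivAt (by
      simpa using WithTop.coe_le_coe.2 (le_top (a := (2 : ℕ∞))))
  change _ = ux (fun p => ut u p.1 p.2) t x
  rw [ux_uncurried_eq_fderiv hd, ut_uncurried_eq_fderiv hd]
  exact (hasDerivAt_time (hv _) t x).deriv.trans <| (hv2 _ _).trans <|
    (hsymm _ _).trans <| (hv2 _ _).symm.trans (hasDerivAt_space (hv _) t x).deriv.symm

theorem ut_uxx_eq_utxx {u : ℝ × ℝ → ℝ} (hu : ContDiff ℝ (⊤ : ℕ∞) u) (t x : ℝ) :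
    ut (fun p => uxx u p.1 p.2) t x = utxx u t x := by
  refine (ut_ux_eq_utx (contDiff_ux_uncurried hu) t x).trans ?_
  change deriv (fun y => ut (fun p => ux u p.1 p.2) t y) x = deriv (fun y => utx u t y) x
  simp only [ut_ux_eq_utx hu]

theorem hasDerivAt_f11 {u : ℝ × ℝ → ℝ} (hu : ContDiff ℝ (⊤ : ℕ∞) u) (t x : ℝ) :
    HasDerivAt (fun s => f11 u s x) (ut u t x - utxx u t x) t := by
  have h0 := (hasDerivAt_time (hu.differentiable (by simp)) t x).differentiableAt.hasDerivAt
  have h2 := (hasDerivAt_time ((contDiff_ux_uncurried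
    (contDiff_ux_uncurried hu)).differentiable (by simp)) t x).differentiableAt.hasDerivAt
  rw [← ut_uxx_eq_utxx hu]
  exact h0.sub h2

theorem hasDerivAt_f12 {u : ℝ × ℝ → ℝ} (hu : ContDiff ℝ (⊤ : ℕ∞) u) (m₁ t x : ℝ) :
    HasDerivAt (fun y => f12 u m₁ t y)
      (4 / m₁ * (ux u t x ^ 2 + u (t, x) * uxx u t x) - 6 * ux u t x * uxx u t x
        - 2 * u (t, x) * uxxx u t x) x := by
  have hu1 := contDiff_ux_uncurried hu
  have h0 : HasDerivAt (fun y => u (t, y)) (ux u t x) x :=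
    (hasDerivAt_space (hu.differentiable (by simp)) t x).differentiableAt.hasDerivAt
  have h1 : HasDerivAt (fun y => ux u t y) (uxx u t x) x :=
    (hasDerivAt_space (hu1.differentiable (by simp)) t x).differentiableAt.hasDerivAt
  have h2 : HasDerivAt (fun y => uxx u t y) (uxxx u t x) x :=
    (hasDerivAt_space ((contDiff_ux_uncurried hu1).differentiable
      (by simp)) t x).differentiableAt.hasDerivAt
  refine (((((h0.const_mul 2).mul (h0.sub h2)).add ((h0.const_mul (4 / m₁)).mul h1)).sub
    ((h1.pow 2).const_mul 2)).sub ((h0.pow 2).const_mul 2)).congr_deriv ?_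
  simp only [Pi.sub_apply]
  ring

/-- The conservation-type identity to which all three structure equations reduce. -/
theorem deriv_f12_sub_deriv_f11 {u : ℝ × ℝ → ℝ} (hu : ContDiff ℝ (⊤ : ℕ∞) u)
    (hsol : IsSolution u) {m₁ : ℝ} (hm₁ : m₁ ∈ ({-2, 1} : Set ℝ)) (t x : ℝ) :
    deriv (fun y => f12 u m₁ t y) x - deriv (fun s => f11 u s x) t = -m₁ * f12 u m₁ t x := by
  rw [(hasDerivAt_f12 hu m₁ t x).deriv, (hasDerivAt_f11 hu t x).deriv, hsol t x, f12]
  rcases hm₁ with rfl | rfl <;> ring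

/-- Equation (∗) describes pseudo-spherical surfaces: on smooth solutions, the one-forms
`ω_i = f_{i1} dx + f_{i2} dt` built from (1.0.3) satisfy the structure equations
`dω₁ = ω₃ ∧ ω₂`, `dω₂ = ω₁ ∧ ω₃`, `dω₃ = ω₁ ∧ ω₂`, written here in components. -/
theorem pss_structure_equations (u : ℝ × ℝ → ℝ) (hu : ContDiff ℝ (⊤ : ℕ∞) u)
    (hsol : IsSolution u) (μ : ℝ) (m₁ : ℝ) (hm₁ : m₁ ∈ ({-2, 1} : Set ℝ))
    (ε : ℝ) (hε : ε ∈ ({1, -1} : Set ℝ)) :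
    ∀ t x : ℝ,
      deriv (fun y => f12 u m₁ t y) x - deriv (fun s => f11 u s x) t
          = f31 u μ m₁ ε t x * f22 u μ m₁ t x - f32 u μ m₁ ε t x * f21 u μ m₁ ε t x ∧
        deriv (fun y => f22 u μ m₁ t y) x - deriv (fun s => f21 u μ m₁ ε s x) t
          = f11 u t x * f32 u μ m₁ ε t x - f12 u m₁ t x * f31 u μ m₁ ε t x ∧
        deriv (fun y => f32 u μ m₁ ε t y) x - deriv (fun s => f31 u μ m₁ ε s x) t
          = f11 u t x * f22 u μ m₁ t x - f12 u m₁ t x * f21 u μ m₁ ε t x := by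
  intro t x
  have key := deriv_f12_sub_deriv_f11 hu hsol hm₁ t x
  have hs : Real.sqrt (1 + μ ^ 2) ^ 2 = 1 + μ ^ 2 := Real.sq_sqrt (by positivity)
  have hε2 : ε ^ 2 = 1 := by rcases hε with rfl | rfl <;> norm_num
  have h12 := (hasDerivAt_f12 hu m₁ t x).differentiableAt
  have h11 := (hasDerivAt_f11 hu t x).differentiableAt
  have h22 : deriv (fun y => f22 u μ m₁ t y) x = μ * deriv (fun y => f12 u m₁ t y) x :=
    deriv_const_mul μ h12
  have h32 : deriv (fun y => f32 u μ m₁ ε t y) x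
      = ε * Real.sqrt (1 + μ ^ 2) * deriv (fun y => f12 u m₁ t y) x :=
    deriv_const_mul _ h12
  have h21 : deriv (fun s => f21 u μ m₁ ε s x) t = μ * deriv (fun s => f11 u s x) t :=
    ((h11.hasDerivAt.const_mul μ).add_const _).deriv
  have h31 : deriv (fun s => f31 u μ m₁ ε s x) t
      = ε * Real.sqrt (1 + μ ^ 2) * deriv (fun s => f11 u s x) t :=
    ((h11.hasDerivAt.const_mul _).add_const _).deriv
  refine ⟨?_, ?_, ?_⟩
  · rw [key, f31, f22, f32, f21]
    linear_combination m₁ * f12 u m₁ t x * (ε ^ 2 * hs + (1 + μ ^ 2) * hε2)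
  · rw [h22, h21, ← mul_sub, key, f11, f32, f31]
    ring
  · rw [h32, h31, ← mul_sub, key, f11, f22, f21]
    ring
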